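/- Let A be an n×n complex random matrix with i.i.d. standard complex Gaussian entries (centered, variance σ² per entry in the sense of density (σ²π)^{-n²} e^{-‖A-Â‖_F²/σ²} with Â = 0). Then E[‖A^{-1}‖_F² |det A|²] = (n/σ²)·E[|det A|²]. -/

import Mathlib

open MeasureTheory

/-- Squared Frobenius norm of a complex n×n matrix. -/
noncomputable def frobSq {n : ℕ} (M : Matrix (Fin n) (Fin n) ℂ) : ℝ :=
  ∑ i, ∑ j, Complex.normSq (M i j)

open scoped ComplexConjugate

section RandomDeterminant

variable {ι X : Type*} [Fintype ι] [DecidableEq ι]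

lemma normSq_det_mul_prod_eq (L : ι → X → ι → ℂ) (W : X → ℂ) (A : ι → X) :
    (Complex.normSq (Matrix.of fun i => L i (A i)).det : ℂ) * ∏ i, W (A i) =
      ∑ π : Equiv.Perm ι, ∑ τ : Equiv.Perm ι,
        ((Equiv.Perm.sign π : ℤ) * (Equiv.Perm.sign τ : ℤ) : ℂ) *
          ∏ i, L i (A i) (π i) * conj (L i (A i) (τ i)) * W (A i) := by
  rw [← Complex.mul_conj, ← Matrix.det_transpose, Matrix.det_apply']
  simp only [map_sum, map_mul, map_prod, map_intCast, Finset.sum_mul, Finset.mul_sum,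
    Finset.prod_mul_distrib, Matrix.transpose_apply, Matrix.of_apply]
  rw [Finset.sum_comm]
  refine Finset.sum_congr rfl fun π _ => Finset.sum_congr rfl fun τ _ => ?_
  ring

variable [MeasureSpace X] [SigmaFinite (volume : Measure X)]

lemma integrable_normSq_det (L : ι → X → ι → ℂ) (W : X → ℂ)
    (hint : ∀ i a b, Integrable fun r => L i r a * conj (L i r b) * W r) :
    Integrable fun A : ι → X =>
      (Complex.normSq (Matrix.of fun i => L i (A i)).det : ℂ) * ∏ i, W (A i) := by
  simp only [normSq_det_mul_prod_eq]
  exact integrable_finsetSum _ fun π _ => integrable_finsetSum _ fun τ _ =>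
    (Integrable.fintype_prod_dep fun i => hint i (π i) (τ i)).const_mul _

/-- The second moment of the determinant of a matrix with independent rows, each with uncorrelated
entries, is the permanent of the matrix of second moments. -/
lemma integral_normSq_det (L : ι → X → ι → ℂ) (W : X → ℂ)
    (hint : ∀ i a b, Integrable fun r => L i r a * conj (L i r b) * W r)
    (hort : ∀ i a b, a ≠ b → ∫ r, L i r a * conj (L i r b) * W r = 0) :
    ∫ A : ι → X, (Complex.normSq (Matrix.of fun i => L i (A i)).det : ℂ) * ∏ i, W (A i) =
      ∑ π : Equiv.Perm ι, ∏ i, ∫ r, L i r (π i) * conj (L i r (π i)) * W r := by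
  have hterm : ∀ (c : ℂ) (π τ : Equiv.Perm ι), Integrable fun A : ι → X =>
      c * ∏ i, L i (A i) (π i) * conj (L i (A i) (τ i)) * W (A i) := fun c π τ =>
    (Integrable.fintype_prod_dep fun i => hint i (π i) (τ i)).const_mul c
  simp only [normSq_det_mul_prod_eq]
  rw [integral_finsetSum _ fun π _ => integrable_finsetSum _ fun τ _ => hterm _ π τ]
  refine Finset.sum_congr rfl fun π _ => ?_
  rw [integral_finsetSum _ fun τ _ => hterm _ π τ, Finset.sum_eq_single π]
  · rw [integral_const_mul, integral_fintype_prod_volume_eq_prod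
      (fun i r => L i r (π i) * conj (L i r (π i)) * W r)]
    rw [← Int.cast_mul, ← Units.val_mul, Int.units_mul_self, Units.val_one, Int.cast_one, one_mul]
  · intro τ _ hτ
    obtain ⟨i, hi⟩ : ∃ i, π i ≠ τ i := by
      by_contra! h
      exact hτ (Equiv.ext fun i => (h i).symm)
    rw [integral_const_mul, integral_fintype_prod_volume_eq_prod
      (fun i r => L i r (π i) * conj (L i r (τ i)) * W r),
      Finset.prod_eq_zero (Finset.mem_univ i) (hort i _ _ hi), mul_zero]
  · simp

end RandomDeterminant

section Gaussian

lemma integrable_norm_rpow_mul_exp_neg_normSq_div {q σ : ℝ} (hq : -2 < q) (hσ : 0 < σ) :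
    Integrable fun z : ℂ => ‖z‖ ^ q * Real.exp (-Complex.normSq z / σ ^ 2) := by
  have h := Complex.integral_rpow_mul_exp_neg_mul_rpow (p := 2) (b := (σ ^ 2)⁻¹) one_le_two hq
    (by positivity)
  have hΓ : 0 < Real.Gamma ((q + 2) / 2) := Real.Gamma_pos_of_pos (by linarith)
  have hi := not_imp_comm.1 integral_undef
    (h.trans_ne (by have := Real.pi_pos; positivity))
  refine hi.congr (.of_forall fun z => ?_)
  simp only [Real.rpow_two, Complex.normSq_eq_norm_sq]
  congr 2
  ring

lemma integral_normSq_mul_exp_neg_normSq_div {σ : ℝ} (hσ : 0 < σ) :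
    ∫ z : ℂ, Complex.normSq z * Real.exp (-Complex.normSq z / σ ^ 2) =
      σ ^ 2 * ∫ z : ℂ, Real.exp (-Complex.normSq z / σ ^ 2) := by
  have key : ∀ q : ℝ, ∀ z : ℂ, ‖z‖ ^ q * Real.exp (-(σ ^ 2)⁻¹ * ‖z‖ ^ (2 : ℝ)) =
      ‖z‖ ^ q * Real.exp (-Complex.normSq z / σ ^ 2) := fun q z => by
    simp only [Real.rpow_two, Complex.normSq_eq_norm_sq]
    congr 2
    ring
  have h2 := Complex.integral_rpow_mul_exp_neg_mul_rpow (p := 2) (q := 2) (b := (σ ^ 2)⁻¹)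
    one_le_two (by norm_num) (by positivity)
  have h0 := Complex.integral_rpow_mul_exp_neg_mul_rpow (p := 2) (q := 0) (b := (σ ^ 2)⁻¹)
    one_le_two (by norm_num) (by positivity)
  simp only [key] at h0 h2
  simp only [Real.rpow_two, ← Complex.normSq_eq_norm_sq] at h2
  simp only [Real.rpow_zero, one_mul] at h0
  rw [h0, h2]
  norm_num
  rw [Real.rpow_neg (by positivity)]
  norm_num
  ring

lemma integrable_mul_exp_of_norm_eq_pow {σ : ℝ} (hσ : 0 < σ) (f : ℂ → ℂ) (k : ℕ) (hf : Continuous f)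
    (hk : ∀ z, ‖f z‖ = ‖z‖ ^ k) :
    Integrable fun z : ℂ => f z * (Real.exp (-Complex.normSq z / σ ^ 2) : ℂ) := by
  have h := integrable_norm_rpow_mul_exp_neg_normSq_div (q := k) (σ := σ)
    (by have : (0 : ℝ) ≤ k := k.cast_nonneg
        linarith) hσ
  refine h.mono ?_ (.of_forall fun z => ?_)
  · have : Continuous fun z : ℂ => f z * (Real.exp (-Complex.normSq z / σ ^ 2) : ℂ) := by
      have := Complex.continuous_normSq
      fun_prop
    exact this.aestronglyMeasurable
  · simp [hk, Complex.norm_real, -Complex.ofReal_exp]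

variable {n : ℕ}

/-- The unnormalised Gaussian weight of a row. -/
noncomputable def rowWeight (σ : ℝ) (r : Fin n → ℂ) : ℂ :=
  ∏ k, (Real.exp (-Complex.normSq (r k) / σ ^ 2) : ℂ)

/-- The factor contributed by the coordinate `k` to the product of the coordinate `a` and the
conjugate of the coordinate `b`. -/
noncomputable def coordFactor (a b k : Fin n) (z : ℂ) : ℂ :=
  (if k = a then z else 1) * (if k = b then conj z else 1)

lemma mul_conj_mul_rowWeight (σ : ℝ) (a b : Fin n) (r : Fin n → ℂ) :
    r a * conj (r b) * rowWeight σ r =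
      ∏ k, coordFactor a b k (r k) * (Real.exp (-Complex.normSq (r k) / σ ^ 2) : ℂ) := by
  simp only [rowWeight, coordFactor, Finset.prod_mul_distrib]
  simp

lemma integrable_coordFactor {σ : ℝ} (hσ : 0 < σ) (a b k : Fin n) :
    Integrable fun z => coordFactor a b k z * (Real.exp (-Complex.normSq z / σ ^ 2) : ℂ) := by
  refine integrable_mul_exp_of_norm_eq_pow hσ _ ((if k = a then 1 else 0) + (if k = b then 1 else 0)) ?_ ?_
  · unfold coordFactor
    split_ifs <;> fun_prop
  · intro z
    unfold coordFactor
    split_ifs <;> simp [sq]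

lemma integrable_rowWeight {σ : ℝ} (hσ : 0 < σ) : Integrable (rowWeight (n := n) σ) := by
  refine Integrable.fintype_prod (f := fun _ z => (Real.exp (-Complex.normSq z / σ ^ 2) : ℂ))
    fun _ => ?_
  simpa using integrable_mul_exp_of_norm_eq_pow hσ (fun _ => 1) 0 continuous_const (by simp)

lemma integrable_mul_conj_mul_rowWeight {σ : ℝ} (hσ : 0 < σ) (a b : Fin n) :
    Integrable fun r : Fin n → ℂ => r a * conj (r b) * rowWeight σ r := by
  simp only [mul_conj_mul_rowWeight]
  exact Integrable.fintype_prod fun k => integrable_coordFactor hσ a b k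

lemma integral_mul_conj_mul_rowWeight_of_ne (σ : ℝ) {a b : Fin n} (hab : a ≠ b) :
    ∫ r : Fin n → ℂ, r a * conj (r b) * rowWeight σ r = 0 := by
  simp only [mul_conj_mul_rowWeight]
  rw [integral_fintype_prod_volume_eq_prod
    (fun k z => coordFactor a b k z * (Real.exp (-Complex.normSq z / σ ^ 2) : ℂ))]
  refine Finset.prod_eq_zero (Finset.mem_univ a) ?_
  refine self_eq_neg.1 ?_
  rw [← integral_neg, ← integral_neg_eq_self]
  simp [coordFactor, hab]

lemma integral_mul_conj_self_mul_rowWeight {σ : ℝ} (hσ : 0 < σ) (a : Fin n) :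
    ∫ r : Fin n → ℂ, r a * conj (r a) * rowWeight σ r =
      (σ : ℂ) ^ 2 * ∫ r : Fin n → ℂ, rowWeight σ r := by
  simp only [mul_conj_mul_rowWeight]
  unfold rowWeight
  rw [integral_fintype_prod_volume_eq_prod
    (fun k z => coordFactor a a k z * (Real.exp (-Complex.normSq z / σ ^ 2) : ℂ)),
    integral_fintype_prod_volume_eq_prod
    (fun _ z => (Real.exp (-Complex.normSq z / σ ^ 2) : ℂ)),
    ← Finset.mul_prod_erase _ _ (Finset.mem_univ a),
    ← Finset.mul_prod_erase _ (fun _ => ∫ z : ℂ, _) (Finset.mem_univ a), ← mul_assoc]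
  congr 1
  · have h := congrArg Complex.ofReal (integral_normSq_mul_exp_neg_normSq_div hσ)
    rw [Complex.ofReal_mul, ← integral_complex_ofReal, ← integral_complex_ofReal] at h
    simpa [coordFactor, Complex.mul_conj] using h
  · refine Finset.prod_congr rfl fun k hk => ?_
    simp [coordFactor, Finset.ne_of_mem_erase hk]

end Gaussian

lemma ae_det_ne_zero (n : ℕ) : ∀ᵐ A : Fin n → Fin n → ℂ, (Matrix.of A).det ≠ 0 := by
  let L : ℂ →ₗ[ℝ] (Fin n → Fin n → ℂ) :=
    { toFun := fun t => (t • (1 : Matrix (Fin n) (Fin n) ℂ) : Matrix (Fin n) (Fin n) ℂ)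
      map_add' := fun s t => add_smul s t (1 : Matrix (Fin n) (Fin n) ℂ)
      map_smul' := fun s t => smul_assoc s t (1 : Matrix (Fin n) (Fin n) ℂ) }
  have hs : MeasurableSet {A : Fin n → Fin n → ℂ | (Matrix.of A).det ≠ 0} := by
    have hc : Continuous fun A : Fin n → Fin n → ℂ => (Matrix.of A).det :=
      Continuous.matrix_det continuous_id
    exact (isOpen_ne_fun hc continuous_const).measurableSet
  have : (volume : Measure (Fin n → Fin n → ℂ)).IsAddHaarMeasure :=
    Measure.pi.isAddHaarMeasure fun _ : Fin n => (volume : Measure (Fin n → ℂ))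
  refine ae_mem_of_ae_add_linearMap_mem L volume volume hs fun A => ?_
  have hfin : {t : ℂ | (-Matrix.of A).charpoly.IsRoot t}.Finite :=
    Polynomial.finite_setOfPred_isRoot (Matrix.charpoly_monic _).ne_zero
  filter_upwards [hfin.countable.ae_notMem volume] with t ht h0
  refine ht ?_
  rw [Polynomial.IsRoot, Matrix.eval_charpoly, ← h0]
  congr 1
  ext i j
  simp [L, Matrix.scalar_apply, Matrix.smul_one_eq_diagonal, add_comm]
  rfl

section Main

variable {n : ℕ}

lemma ofReal_exp_neg_frobSq_div (σ : ℝ) (A : Fin n → Fin n → ℂ) :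
    (Real.exp (-frobSq (Matrix.of A) / σ ^ 2) : ℂ) = ∏ i, rowWeight σ (A i) := by
  simp only [rowWeight, ← Complex.ofReal_prod, ← Real.exp_sum, frobSq, Matrix.of_apply,
    ← Finset.sum_div, Finset.sum_neg_distrib]

lemma adjugate_eq_det_rows (A : Fin n → Fin n → ℂ) (i j : Fin n) :
    (Matrix.of A).adjugate j i =
      (Matrix.of fun k => if k = i then Pi.single j (1 : ℂ) else A k).det := by
  rw [Matrix.adjugate_apply]
  congr 1
  ext k l
  by_cases hk : k = i
  · subst hk; simp
  · simp [hk]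

lemma frobSq_inv_mul_normSq_det {A : Matrix (Fin n) (Fin n) ℂ} (hA : A.det ≠ 0) :
    frobSq A⁻¹ * Complex.normSq A.det = frobSq A.adjugate := by
  simp only [frobSq, Finset.sum_mul, Matrix.inv_def, Matrix.smul_apply, smul_eq_mul, map_mul,
    Ring.inverse_eq_inv', map_inv₀]
  refine Finset.sum_congr rfl fun i _ => Finset.sum_congr rfl fun j _ => ?_
  have : Complex.normSq A.det ≠ 0 := by simpa using hA
  field_simp

lemma integrable_replaceRow {σ : ℝ} (hσ : 0 < σ) (i j k a b : Fin n) :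
    Integrable fun r : Fin n → ℂ => (if k = i then Pi.single j (1 : ℂ) else r : Fin n → ℂ) a *
      conj ((if k = i then Pi.single j (1 : ℂ) else r : Fin n → ℂ) b) * rowWeight σ r := by
  split_ifs
  · exact (integrable_rowWeight hσ).const_mul _
  · exact integrable_mul_conj_mul_rowWeight hσ a b

lemma integrable_normSq_adjugate {σ : ℝ} (hσ : 0 < σ) (i j : Fin n) :
    Integrable fun A : Fin n → Fin n → ℂ =>
      (Complex.normSq ((Matrix.of A).adjugate j i) : ℂ) * ∏ k, rowWeight σ (A k) := by
  simp only [adjugate_eq_det_rows]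
  exact integrable_normSq_det (fun k r => if k = i then Pi.single j (1 : ℂ) else r) (rowWeight σ)
    (integrable_replaceRow hσ i j)

lemma integral_normSq_adjugate {σ : ℝ} (hσ : 0 < σ) (i j : Fin n) :
    ∫ A : Fin n → Fin n → ℂ,
        (Complex.normSq ((Matrix.of A).adjugate j i) : ℂ) * ∏ k, rowWeight σ (A k) =
      ∑ π : Equiv.Perm (Fin n), if π i = j then
        (∫ r : Fin n → ℂ, rowWeight σ r) *
          ∏ _k ∈ Finset.univ.erase i, ((σ : ℂ) ^ 2 * ∫ r : Fin n → ℂ, rowWeight σ r) else 0 := by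
  simp only [adjugate_eq_det_rows]
  rw [integral_normSq_det (fun k r => if k = i then Pi.single j (1 : ℂ) else r) (rowWeight σ)
    (integrable_replaceRow hσ i j)]
  · refine Finset.sum_congr rfl fun π _ => ?_
    rw [← Finset.mul_prod_erase _ _ (Finset.mem_univ i)]
    by_cases h : π i = j
    · rw [if_pos h]
      congr 1
      · simp [h]
      · refine Finset.prod_congr rfl fun k hk => ?_
        simp only [Finset.ne_of_mem_erase hk, if_false]
        exact integral_mul_conj_self_mul_rowWeight hσ _
    · simp [h]
  · intro k a b hab
    split_ifs
    · have : (Pi.single j (1 : ℂ) : Fin n → ℂ) a *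
          conj ((Pi.single j (1 : ℂ) : Fin n → ℂ) b) = 0 := by
        by_cases ha : a = j
        · have hb : b ≠ j := fun hb => hab (ha.trans hb.symm)
          simp [hb]
        · simp [ha]
      simp [this]
    · exact integral_mul_conj_mul_rowWeight_of_ne σ hab

lemma integral_normSq_det_gaussian {σ : ℝ} (hσ : 0 < σ) :
    ∫ A : Fin n → Fin n → ℂ,
        (Complex.normSq (Matrix.of A).det : ℂ) * ∏ k, rowWeight σ (A k) =
      ∑ _π : Equiv.Perm (Fin n), ∏ _k : Fin n, ((σ : ℂ) ^ 2 * ∫ r : Fin n → ℂ, rowWeight σ r) := by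
  refine (integral_normSq_det (fun _ r => r) (rowWeight σ)
    (fun _ => integrable_mul_conj_mul_rowWeight hσ)
    (fun _ _ _ => integral_mul_conj_mul_rowWeight_of_ne σ)).trans ?_
  simp only [integral_mul_conj_self_mul_rowWeight hσ]

/-- Expanding the determinant along the row `i`. -/
lemma sq_mul_sum_integral_normSq_adjugate {σ : ℝ} (hσ : 0 < σ) (i : Fin n) :
    (σ : ℂ) ^ 2 * ∑ j, ∫ A : Fin n → Fin n → ℂ,
        (Complex.normSq ((Matrix.of A).adjugate j i) : ℂ) * ∏ k, rowWeight σ (A k) =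
      ∫ A : Fin n → Fin n → ℂ,
        (Complex.normSq (Matrix.of A).det : ℂ) * ∏ k, rowWeight σ (A k) := by
  simp only [integral_normSq_adjugate hσ, integral_normSq_det_gaussian hσ]
  rw [Finset.sum_comm, Finset.mul_sum]
  refine Finset.sum_congr rfl fun π _ => ?_
  rw [Finset.sum_ite_eq, if_pos (Finset.mem_univ _), ← mul_assoc,
    ← Finset.mul_prod_erase Finset.univ (fun _ => (σ : ℂ) ^ 2 * _) (Finset.mem_univ i)]

theorem sq_mul_integral_frobSq_adjugate {σ : ℝ} (hσ : 0 < σ) :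
    σ ^ 2 * ∫ A : Fin n → Fin n → ℂ,
        frobSq (Matrix.of A).adjugate * Real.exp (-frobSq (Matrix.of A) / σ ^ 2) =
      n * ∫ A : Fin n → Fin n → ℂ, Complex.normSq (Matrix.of A).det *
        Real.exp (-frobSq (Matrix.of A) / σ ^ 2) := by
  apply Complex.ofReal_injective
  rw [Complex.ofReal_mul, Complex.ofReal_mul, ← integral_complex_ofReal, ← integral_complex_ofReal]
  simp only [Complex.ofReal_mul, ofReal_exp_neg_frobSq_div]
  simp only [frobSq, Complex.ofReal_sum, Finset.sum_mul]
  rw [integral_finsetSum _ fun j _ => integrable_finsetSum _ fun i _ =>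
    integrable_normSq_adjugate hσ i j]
  simp only [integral_finsetSum _ fun i _ => integrable_normSq_adjugate hσ i _]
  rw [Finset.sum_comm, Finset.mul_sum, Complex.ofReal_pow]
  simp only [sq_mul_sum_integral_normSq_adjugate hσ]
  simp

end Main

/- STATEMENT 19: For A an n×n matrix of i.i.d. centered complex Gaussian entries, with
density (σ²π)^{-n²} e^{-‖A‖_F²/σ²}, one has E[‖A⁻¹‖_F² |det A|²] = (n/σ²)·E[|det A|²]. -/
theorem stmt_19 {n : ℕ} (hn : 1 ≤ n) (σ : ℝ) (hσ : 0 < σ) :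
    ((σ ^ 2 * Real.pi) ^ (n ^ 2))⁻¹ *
        ∫ A : Fin n → Fin n → ℂ,
          frobSq (Matrix.of A)⁻¹ * Complex.normSq (Matrix.det (Matrix.of A)) *
            Real.exp (-frobSq (Matrix.of A) / σ ^ 2) =
      ((n : ℝ) / σ ^ 2) *
        (((σ ^ 2 * Real.pi) ^ (n ^ 2))⁻¹ *
          ∫ A : Fin n → Fin n → ℂ,
            Complex.normSq (Matrix.det (Matrix.of A)) *
              Real.exp (-frobSq (Matrix.of A) / σ ^ 2)) := by
  have hadj : ∫ A : Fin n → Fin n → ℂ,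
      frobSq (Matrix.of A)⁻¹ * Complex.normSq (Matrix.det (Matrix.of A)) *
        Real.exp (-frobSq (Matrix.of A) / σ ^ 2) =
      ∫ A : Fin n → Fin n → ℂ,
        frobSq (Matrix.of A).adjugate * Real.exp (-frobSq (Matrix.of A) / σ ^ 2) := by
    refine integral_congr_ae ?_
    filter_upwards [ae_det_ne_zero n] with A hA
    rw [frobSq_inv_mul_normSq_det hA]
  have h := sq_mul_integral_frobSq_adjugate (n := n) hσ
  rw [hadj, mul_left_comm, div_mul_eq_mul_div, ← h, mul_div_cancel_left₀ _ (by positivity)]
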